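/- Let B ∈ ℤ^{m×n} with columns b₁,…,bₙ, and let (ℂ*)^m act on ℂⁿ by (t ⋄ x)ⱼ = t^{bⱼ} xⱼ. Suppose G ∈ ℂ[x₁,…,xₙ] is an irreducible polynomial that is not B-homogeneous. Then the Zariski closure in ℂⁿ of the swept set {t ⋄ x : t ∈ (ℂ*)^m, x ∈ Var(G)} is all of ℂⁿ; equivalently, the only polynomial in ℂ[x₁,…,xₙ] vanishing at every point t ⋄ x with t ∈ (ℂ*)^m and G(x) = 0 is the zero polynomial. -/

import Mathlib

open MvPolynomial

/-- A nonzero polynomial `f ∈ ℂ[x₁,…,xₙ]` is `B`-homogeneous if `Bu = Bv` for every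
pair of exponent vectors `u, v` in the support of `f`. -/
def BHomogeneous (m n : ℕ) (B : Matrix (Fin m) (Fin n) ℤ)
    (f : MvPolynomial (Fin n) ℂ) : Prop :=
  ∀ u ∈ f.support, ∀ v ∈ f.support, ∀ i : Fin m,
    ∑ j, B i j * (u j : ℤ) = ∑ j, B i j * (v j : ℤ)

/-- The action of the torus `(ℂ*)ᵐ` on `ℂⁿ` determined by `B`:
`(t ⋄ x)ⱼ = t^{bⱼ} xⱼ`. -/
noncomputable def torusAct (m n : ℕ) (B : Matrix (Fin m) (Fin n) ℤ)
    (t : Fin m → ℂ) (x : Fin n → ℂ) : Fin n → ℂ :=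
  fun j => (∏ i, t i ^ B i j) * x j

/-- The Zariski closure of a subset of `ℂⁿ`. -/
def zClosure {σ : Type*} (Z : Set (σ → ℂ)) : Set (σ → ℂ) :=
  { p | ∀ f : MvPolynomial σ ℂ, (∀ q ∈ Z, eval q f = 0) → eval p f = 0 }

/-- Rescaling of the variables. -/
noncomputable def scaleHom {n : ℕ} (c : Fin n → ℂ) :
    MvPolynomial (Fin n) ℂ →ₐ[ℂ] MvPolynomial (Fin n) ℂ :=
  aeval (fun j => C (c j) * X j)

lemma scaleHom_monomial {n : ℕ} (c : Fin n → ℂ) (u : Fin n →₀ ℕ) (a : ℂ) :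
    scaleHom c (monomial u a) = monomial u ((∏ j, c j ^ u j) * a) := by
  rw [scaleHom, aeval_monomial, Finsupp.prod_fintype _ _ (by simp)]
  simp only [mul_pow, Finset.prod_mul_distrib]
  rw [monomial_eq, Finsupp.prod_fintype _ _ (by simp)]
  simp [algebraMap_eq, map_prod]
  ring

lemma coeff_scaleHom {n : ℕ} (c : Fin n → ℂ) (u : Fin n →₀ ℕ) (f : MvPolynomial (Fin n) ℂ) :
    coeff u (scaleHom c f) = (∏ j, c j ^ u j) * coeff u f := by
  induction f using MvPolynomial.induction_on' with
  | monomial v a =>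
    rw [scaleHom_monomial, coeff_monomial, coeff_monomial]
    split_ifs with h
    · rw [h]
    · simp
  | add p q hp hq => rw [map_add, coeff_add, coeff_add, hp, hq, mul_add]

lemma eval_scaleHom {n : ℕ} (c x : Fin n → ℂ) (f : MvPolynomial (Fin n) ℂ) :
    eval x (scaleHom c f) = eval (fun j => c j * x j) f := by
  induction f using MvPolynomial.induction_on with
  | C a => simp [scaleHom]
  | add p q hp hq => simp [hp, hq]
  | mul_X p j hp => simp only [map_mul, hp]; simp [scaleHom]

lemma scaleHom_scaleHom {n : ℕ} (c d : Fin n → ℂ) (h : ∀ j, c j * d j = 1)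
    (f : MvPolynomial (Fin n) ℂ) : scaleHom c (scaleHom d f) = f := by
  ext u
  rw [coeff_scaleHom, coeff_scaleHom, ← mul_assoc, ← Finset.prod_mul_distrib]
  simp [← mul_pow, h]

/-- Rescaling as an automorphism. -/
noncomputable def scaleEquiv {n : ℕ} (c d : Fin n → ℂ) (h : ∀ j, c j * d j = 1) :
    MvPolynomial (Fin n) ℂ ≃* MvPolynomial (Fin n) ℂ where
  toFun := scaleHom c
  invFun := scaleHom d
  left_inv := scaleHom_scaleHom d c (fun j => by rw [mul_comm, h])
  right_inv := scaleHom_scaleHom c d h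
  map_mul' := map_mul _

lemma dvd_of_vanish {n : ℕ} (G f : MvPolynomial (Fin n) ℂ) (hG : Irreducible G)
    (h : ∀ x, eval x G = 0 → eval x f = 0) : G ∣ f := by
  have hp : Prime G := hG.prime
  have h1 : f ∈ vanishingIdeal ℂ (zeroLocus ℂ (Ideal.span {G})) := by
    rw [mem_vanishingIdeal_iff]
    intro x hx
    rw [mem_zeroLocus_iff] at hx
    have := hx G (Ideal.mem_span_singleton_self G)
    rw [aeval_eq_eval] at *
    exact h x this
  rw [vanishingIdeal_zeroLocus_eq_radical,
    ((Ideal.span_singleton_prime hp.ne_zero).2 hp).radical, Ideal.mem_span_singleton] at h1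
  exact h1

lemma prod_zpow_pow {n : ℕ} (s : ℂ) (hs : s ≠ 0) (w : Fin n → ℤ) (u : Fin n →₀ ℕ) :
    ∏ j, (s ^ w j) ^ u j = s ^ (∑ j, w j * (u j : ℤ)) := by
  have : ∀ t : Finset (Fin n), ∏ j ∈ t, (s ^ w j) ^ u j = s ^ (∑ j ∈ t, w j * (u j : ℤ)) := by
    intro t
    induction t using Finset.induction_on with
    | empty => simp
    | insert a t ha ih =>
      rw [Finset.prod_insert ha, Finset.sum_insert ha, ih, zpow_add₀ hs, zpow_mul, zpow_natCast]
  exact this _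

lemma sweep_key {n : ℕ} (w : Fin n → ℤ) (G f : MvPolynomial (Fin n) ℂ) (hG : Irreducible G)
    (u v : Fin n →₀ ℕ) (hu : u ∈ G.support) (hv : v ∈ G.support)
    (huv : ∑ j, w j * (u j : ℤ) ≠ ∑ j, w j * (v j : ℤ))
    (hf : ∀ (s : ℂ) (x : Fin n → ℂ), s ≠ 0 → eval x G = 0 →
      eval (fun j => s ^ w j * x j) f = 0) : f = 0 := by
  by_contra hf0
  let s : ℕ → ℂ := fun k => 2 ^ k
  have hs : ∀ k, s k ≠ 0 := fun k => by simp [s]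
  let c : ℕ → Fin n → ℂ := fun k j => (s k) ^ w j
  let d : ℕ → Fin n → ℂ := fun k j => (s k)⁻¹ ^ w j
  have hcd : ∀ k j, c k j * d k j = 1 := fun k j => by
    simp only [c, d]
    rw [← mul_zpow, mul_inv_cancel₀ (hs k), one_zpow]
  have hirr : ∀ k, Irreducible (scaleHom (c k) G) := fun k =>
    (MulEquiv.irreducible_iff (scaleEquiv (c k) (d k) (hcd k))).2 hG
  have hdvd : ∀ k, scaleHom (c k) G ∣ f := fun k => by
    have h1 : G ∣ scaleHom (d k) f := by
      apply dvd_of_vanish _ _ hG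
      intro x hx
      rw [eval_scaleHom]
      exact hf _ x (inv_ne_zero (hs k)) hx
    have h2 := map_dvd (scaleHom (c k)) h1
    rwa [scaleHom_scaleHom _ _ (hcd k)] at h2
  have hex : ∀ k, ∃ q ∈ UniqueFactorizationMonoid.factors f, Associated (scaleHom (c k) G) q :=
    fun k => UniqueFactorizationMonoid.exists_mem_factors_of_dvd hf0 (hirr k) (hdvd k)
  choose q hq hqa using hex
  classical
  obtain ⟨k, l, hkl, he⟩ := Finite.exists_ne_map_eq_of_infinite
    (fun k => (⟨q k, Multiset.mem_toFinset.2 (hq k)⟩ :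
      {x // x ∈ (UniqueFactorizationMonoid.factors f).toFinset}))
  have he' : q k = q l := congrArg Subtype.val he
  have hass : Associated (scaleHom (c k) G) (scaleHom (c l) G) :=
    (hqa k).trans (he' ▸ (hqa l).symm)
  obtain ⟨e, hee⟩ := hass
  obtain ⟨a, ha, hae⟩ := MvPolynomial.isUnit_iff_eq_C_of_isReduced.1 e.isUnit
  rw [hae] at hee
  have hco : ∀ z ∈ G.support, (s k) ^ (∑ j, w j * (z j : ℤ)) * a =
      (s l) ^ (∑ j, w j * (z j : ℤ)) := by
    intro z hz
    have h := congrArg (coeff z) hee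
    rw [mul_comm, coeff_C_mul, coeff_scaleHom, coeff_scaleHom] at h
    simp only [c] at h
    rw [prod_zpow_pow _ (hs k), prod_zpow_pow _ (hs l)] at h
    have hz' := mem_support_iff.1 hz
    apply mul_right_cancel₀ hz'
    rw [← h]; ring
  have h1 := hco u hu
  have h2 := hco v hv
  generalize ∑ j, w j * (u j : ℤ) = p at *
  generalize ∑ j, w j * (v j : ℤ) = r at *
  have ha0 : a ≠ 0 := ha.ne_zero
  have h3 : (s k) ^ p * (s l) ^ r = (s l) ^ p * (s k) ^ r := by
    rw [← h1, ← h2]; ring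
  have h4 : (2:ℂ) ^ ((k:ℤ) * p + l * r) = (2:ℂ) ^ ((l:ℤ) * p + k * r) := by
    rw [zpow_add₀ two_ne_zero, zpow_add₀ two_ne_zero, zpow_mul, zpow_mul, zpow_mul, zpow_mul]
    simpa [s] using h3
  have h5 : (2:ℝ) ^ ((k:ℤ) * p + l * r) = (2:ℝ) ^ ((l:ℤ) * p + k * r) := by
    have := congrArg (fun z : ℂ => ‖z‖) h4
    simpa only [norm_zpow, Complex.norm_ofNat] using this
  have h6 := zpow_right_injective₀ (by norm_num : (0:ℝ) < 2) (by norm_num) h5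
  have h7 : ((k:ℤ) - l) * (p - r) = 0 := by linear_combination h6
  rcases mul_eq_zero.1 h7 with h | h
  · apply hkl; omega
  · apply huv; omega

/-- **Lemma.** If `G` is an irreducible polynomial that is not `B`-homogeneous, then the
Zariski closure of the torus sweep of `Var(G)` is all of `ℂⁿ`; equivalently, the only
polynomial vanishing on all points `t ⋄ x` with `t ∈ (ℂ*)ᵐ` and `G(x) = 0` is the zero
polynomial. -/
theorem sweep_dense_of_not_bHomogeneous (m n : ℕ) (hm : 1 ≤ m) (hn : 1 ≤ n)
    (B : Matrix (Fin m) (Fin n) ℤ)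
    (G : MvPolynomial (Fin n) ℂ) (hG : Irreducible G)
    (hnb : ¬ BHomogeneous m n B G) :
    zClosure { y | ∃ (t : Fin m → ℂ) (x : Fin n → ℂ),
        (∀ i, t i ≠ 0) ∧ eval x G = 0 ∧ y = torusAct m n B t x } = Set.univ ∧
    ∀ f : MvPolynomial (Fin n) ℂ,
      (∀ (t : Fin m → ℂ) (x : Fin n → ℂ), (∀ i, t i ≠ 0) → eval x G = 0 →
        eval (torusAct m n B t x) f = 0) → f = 0 := by
  have main : ∀ f : MvPolynomial (Fin n) ℂ,
      (∀ (t : Fin m → ℂ) (x : Fin n → ℂ), (∀ i, t i ≠ 0) → eval x G = 0 →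
        eval (torusAct m n B t x) f = 0) → f = 0 := by
    intro f hf
    unfold BHomogeneous at hnb
    push Not at hnb
    obtain ⟨u, hu, v, hv, i, huv⟩ := hnb
    refine sweep_key (fun j => B i j) G f hG u v hu hv huv ?_
    intro s x hs hx
    have := hf (fun i' => if i' = i then s else 1) x
      (fun i' => by split_ifs <;> simp [hs]) hx
    convert this using 3
    funext j
    have hprod : ∏ i', (if i' = i then s else 1) ^ B i' j = s ^ B i j := by
      rw [Finset.prod_eq_single i]
      · simp
      · intro b _ hb
        simp [hb]
      · simp
    simp only [torusAct, hprod]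
  refine ⟨?_, main⟩
  rw [Set.eq_univ_iff_forall]
  intro p f hf
  rw [main f fun t x ht hx => hf _ ⟨t, x, ht, hx, rfl⟩, map_zero]
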